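/- Let ℬ be a Markushevich basis of 𝕏 and w a weight. If ℬ is s-w-semi-greedy for some 0 < s ≤ 1 (i.e., C-s-w-semi-greedy for some constant C > 0), then ℬ is truncation quasi-greedy, w-superdemocratic, and has the w-Property (A). -/

import Mathlib

open scoped BigOperators ENNReal
open Filter

noncomputable section

namespace GreedyPaper

variable {𝕜 : Type*} [RCLike 𝕜] {X : Type*} [NormedAddCommGroup X] [NormedSpace 𝕜 X]

/-- Support of `x` with respect to the coordinate functionals `f`. -/
def msupp (f : ℕ → X →L[𝕜] 𝕜) (x : X) : Set ℕ := {i | f i x ≠ 0}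

/-- Projection onto a finite set of coordinates. -/
def proj (e : ℕ → X) (f : ℕ → X →L[𝕜] 𝕜) (A : Finset ℕ) (x : X) : X :=
  ∑ i ∈ A, f i x • e i

/-- `A` is an `m`-`t`-greedy set for `x`: `|A| = m` and
`min_{j ∈ A} |f j x| ≥ t · sup_{k ∉ A} |f k x|`. -/
def GreedySet (f : ℕ → X →L[𝕜] 𝕜) (x : X) (m : ℕ) (t : ℝ) (A : Finset ℕ) : Prop :=
  A.card = m ∧ ∀ j ∈ A, ∀ k ∉ A, t * ‖f k x‖ ≤ ‖f j x‖

/-- `w`-measure of a set of indices, with value in `ℝ≥0∞` (possibly infinite). -/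
def wsum (w : ℕ → ℝ) (S : Set ℕ) : ℝ≥0∞ := ∑' i : S, ENNReal.ofReal (w i)

/-- Sign of a scalar: `sgn 0 = 1` and `sgn t * t = |t|`. -/
def sgn (t : 𝕜) : 𝕜 := if t = 0 then 1 else (‖t‖ : 𝕜) / t

/-- A Markushevich basis (with the boundedness assumptions of the paper):
biorthogonality, dense span, totality of the coordinate functionals, and boundedness
of both the basis vectors and the coordinate functionals. -/
structure IsMarkushevichBasis (e : ℕ → X) (f : ℕ → X →L[𝕜] 𝕜) : Prop where
  biorth : ∀ i j, f i (e j) = if i = j then 1 else 0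
  dense_span : Dense ((Submodule.span 𝕜 (Set.range e) : Submodule 𝕜 X) : Set X)
  total : ∀ x : X, (∀ i, f i x = 0) → x = 0
  bddE : BddAbove (Set.range fun i => ‖e i‖)
  bddF : BddAbove (Set.range fun i => ‖f i‖)

/-- `ℬ` is `C`-`s`-`w`-semi-greedy: for every `x` and `m` there are an `m`-`s`-greedy set `A`
and `y` supported in `A` with `‖x - y‖ ≤ C · inf {‖x - z‖ : supp z finite, w(supp z) ≤ w(A)}`. -/
def SemiGreedy (e : ℕ → X) (f : ℕ → X →L[𝕜] 𝕜) (w : ℕ → ℝ) (C s : ℝ) : Prop :=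
  ∀ (x : X) (m : ℕ), ∃ A : Finset ℕ, GreedySet f x m s A ∧
    ∃ y : X, msupp f y ⊆ (A : Set ℕ) ∧
      ∀ z : X, (msupp f z).Finite → wsum w (msupp f z) ≤ wsum w (A : Set ℕ) →
        ‖x - y‖ ≤ C * ‖x - z‖

/-- `ℬ` is `C`-`s`-`w`-almost semi-greedy. -/
def AlmostSemiGreedy (e : ℕ → X) (f : ℕ → X →L[𝕜] 𝕜) (w : ℕ → ℝ) (C s : ℝ) : Prop :=
  ∀ (x : X) (m : ℕ), ∃ A : Finset ℕ, GreedySet f x m s A ∧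
    ∃ y : X, msupp f y ⊆ (A : Set ℕ) ∧
      ∀ B : Finset ℕ, wsum w (B : Set ℕ) ≤ wsum w (A : Set ℕ) →
        ‖x - y‖ ≤ C * ‖x - proj e f B x‖

/-- `ℬ` is `C`-`w`-almost greedy. -/
def AlmostGreedy (e : ℕ → X) (f : ℕ → X →L[𝕜] 𝕜) (w : ℕ → ℝ) (C : ℝ) : Prop :=
  ∀ (x : X) (m : ℕ) (A : Finset ℕ), GreedySet f x m 1 A →
    ∀ B : Finset ℕ, wsum w (B : Set ℕ) ≤ wsum w (A : Set ℕ) →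
      ‖x - proj e f A x‖ ≤ C * ‖x - proj e f B x‖

/-- `ℬ` is `C`-`w`-disjoint almost greedy. -/
def DisjointAlmostGreedy (e : ℕ → X) (f : ℕ → X →L[𝕜] 𝕜) (w : ℕ → ℝ) (C : ℝ) : Prop :=
  ∀ (x : X) (m : ℕ) (A : Finset ℕ), GreedySet f x m 1 A →
    ∀ B : Finset ℕ, wsum w (B : Set ℕ) ≤ wsum w (A : Set ℕ) → Disjoint B A →
      ‖x - proj e f A x‖ ≤ C * ‖x - proj e f B x‖

/-- `ℬ` is `C`-`s`-`w`-almost greedy in the weak sense. -/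
def WeakAlmostGreedy (e : ℕ → X) (f : ℕ → X →L[𝕜] 𝕜) (w : ℕ → ℝ) (C s : ℝ) : Prop :=
  ∀ (x : X) (m : ℕ), ∃ A : Finset ℕ, GreedySet f x m s A ∧
    ∀ B : Finset ℕ, wsum w (B : Set ℕ) ≤ wsum w (A : Set ℕ) →
      ‖x - proj e f A x‖ ≤ C * ‖x - proj e f B x‖

/-- `ℬ` is `C`-`w`-superdemocratic. -/
def SuperDemocratic (e : ℕ → X) (f : ℕ → X →L[𝕜] 𝕜) (w : ℕ → ℝ) (C : ℝ) : Prop :=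
  ∀ (A B : Finset ℕ) (ε ε' : ℕ → 𝕜), (∀ i ∈ A, ‖ε i‖ = 1) → (∀ i ∈ B, ‖ε' i‖ = 1) →
    wsum w (A : Set ℕ) ≤ wsum w (B : Set ℕ) →
      ‖∑ i ∈ A, ε i • e i‖ ≤ C * ‖∑ i ∈ B, ε' i • e i‖

/-- `ℬ` is `C`-`w`-democratic. -/
def Democratic (e : ℕ → X) (f : ℕ → X →L[𝕜] 𝕜) (w : ℕ → ℝ) (C : ℝ) : Prop :=
  ∀ A B : Finset ℕ, wsum w (A : Set ℕ) ≤ wsum w (B : Set ℕ) →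
    ‖∑ i ∈ A, e i‖ ≤ C * ‖∑ i ∈ B, e i‖

/-- `ℬ` is `C`-truncation quasi-greedy. -/
def TruncationQuasiGreedy (e : ℕ → X) (f : ℕ → X →L[𝕜] 𝕜) (C : ℝ) : Prop :=
  ∀ (x : X) (m : ℕ) (A : Finset ℕ) (hA : A.Nonempty), GreedySet f x m 1 A →
    (A.inf' hA fun i => ‖f i x‖) * ‖∑ i ∈ A, sgn (f i x) • e i‖ ≤ C * ‖x‖

/-- `ℬ` has the `C`-`w`-Property (A). -/
def PropertyA (e : ℕ → X) (f : ℕ → X →L[𝕜] 𝕜) (w : ℕ → ℝ) (C : ℝ) : Prop :=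
  ∀ x : X, (∀ i, ‖f i x‖ ≤ 1) →
    ∀ A B : Finset ℕ, wsum w (A : Set ℕ) ≤ wsum w (B : Set ℕ) → Disjoint A B →
      (∀ i ∈ A ∪ B, f i x = 0) →
      ∀ ε ε' : ℕ → 𝕜, (∀ i ∈ A, ‖ε i‖ = 1) → (∀ i ∈ B, ‖ε' i‖ = 1) →
        ‖x + ∑ i ∈ A, ε i • e i‖ ≤ C * ‖x + ∑ i ∈ B, ε' i • e i‖

/-- The finite dimensional separation property (FDSP) with constant `M`. -/
def FDSP (e : ℕ → X) (M : ℝ) : Prop :=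
  ∀ Z : Submodule 𝕜 X, IsClosed (Z : Set X) → TopologicalSpace.IsSeparable (Z : Set X) →
    ∀ ε : ℝ, 0 < ε → ∃ k : ℕ → ℕ, StrictMono k ∧
      (∀ (a : ℕ → 𝕜) (n l : ℕ), n ≤ l →
        ‖∑ j ∈ Finset.range (n + 1), a j • e (k j)‖ ≤
          (M + ε) * ‖∑ j ∈ Finset.range (l + 1), a j • e (k j)‖) ∧
      (∀ F : Submodule 𝕜 X, F ≤ Z → FiniteDimensional 𝕜 F →
        ∃ N : ℕ, ∀ x ∈ F,
          ∀ z ∈ closure ((Submodule.span 𝕜 {v : X | ∃ n, N < n ∧ v = e (k n)} :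
              Submodule 𝕜 X) : Set X),
            ‖x‖ ≤ (M + ε) * ‖x + z‖)

/-- `v` is a block basis of `e`. -/
def IsBlockBasis (e v : ℕ → X) : Prop :=
  ∃ (b : ℕ → 𝕜) (n m : ℕ → ℕ), (∀ i, n i ≤ m i) ∧ (∀ i, m i < n (i + 1)) ∧
    (∀ i, v i = ∑ k ∈ Finset.Icc (n i) (m i), b k • e k) ∧
    (∀ i, ∃ k ∈ Finset.Icc (n i) (m i), b k ≠ 0)

section Weights

variable {w : ℕ → ℝ}

lemma wsum_coe (hw : ∀ i, 0 < w i) (A : Finset ℕ) :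
    wsum w (A : Set ℕ) = ENNReal.ofReal (∑ i ∈ A, w i) := by
  rw [wsum, ENNReal.ofReal_sum_of_nonneg fun i _ => (hw i).le]
  exact Finset.tsum_subtype A fun i => ENNReal.ofReal (w i)

lemma wsum_coe_le_iff (hw : ∀ i, 0 < w i) (A B : Finset ℕ) :
    wsum w (A : Set ℕ) ≤ wsum w (B : Set ℕ) ↔ ∑ i ∈ A, w i ≤ ∑ i ∈ B, w i := by
  rw [wsum_coe hw, wsum_coe hw,
    ENNReal.ofReal_le_ofReal_iff (Finset.sum_nonneg fun i _ => (hw i).le)]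

/-- A finite set of weight at least `W > 0` contains a set whose weight crosses `W` at its last
element. -/
lemma exists_insert_weight_ge {W : ℝ} (hW : 0 < W) (T : Finset ℕ) :
    W ≤ ∑ i ∈ T, w i → ∃ D ⊆ T, ∃ n ∈ T, n ∉ D ∧
      ∑ i ∈ D, w i < W ∧ W ≤ ∑ i ∈ insert n D, w i := by
  induction T using Finset.induction_on with
  | empty => intro h; simp at h; linarith
  | insert a T ha ih =>
    intro h
    by_cases hT : W ≤ ∑ i ∈ T, w i
    · obtain ⟨D, hD, n, hn, h1⟩ := ih hT
      exact ⟨D, hD.trans (Finset.subset_insert _ _), n, Finset.mem_insert_of_mem hn, h1⟩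
    · exact ⟨T, Finset.subset_insert _ _, a, Finset.mem_insert_self _ _, ha, not_le.1 hT, h⟩

lemma summable_indicator_of_sum_le (hw : ∀ i, 0 < w i) {S : Set ℕ} {c : ℝ}
    (h : ∀ T : Finset ℕ, (T : Set ℕ) ⊆ S → ∑ i ∈ T, w i ≤ c) : Summable (S.indicator w) := by
  classical
  refine summable_of_sum_le (c := c) (fun i => Set.indicator_nonneg (fun j _ => (hw j).le) i)
    fun T => ?_
  have := h (T.filter (· ∈ S)) (by intro i hi; simpa using (Finset.mem_filter.1 hi).2)
  rwa [Finset.sum_filter] at this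

/-- The filter of sets of indices whose complement has finite weight. -/
def cosummable (w : ℕ → ℝ) (hw : ∀ i, 0 < w i) : Filter ℕ where
  sets := {S | Summable (Sᶜ.indicator w)}
  univ_sets := by simp
  sets_of_superset := by
    intro S T hS hST
    refine Summable.of_nonneg_of_le (fun i => Set.indicator_nonneg (fun j _ => (hw j).le) i)
      (fun i => ?_) hS
    exact Set.indicator_le_indicator_of_subset (Set.compl_subset_compl.2 hST)
      (fun j => (hw j).le) i
  inter_sets := by
    intro S T hS hT
    refine Summable.of_nonneg_of_le (fun i => Set.indicator_nonneg (fun j _ => (hw j).le) i)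
      (fun i => ?_) (Summable.add hS hT)
    have := (hw i).le
    by_cases h1 : i ∈ S <;> by_cases h2 : i ∈ T <;> simp [Set.indicator, h1, h2, this]

lemma mem_cosummable {hw : ∀ i, 0 < w i} {S : Set ℕ} :
    S ∈ cosummable w hw ↔ Summable (Sᶜ.indicator w) := Iff.rfl

lemma cosummable_neBot (hw : ∀ i, 0 < w i) (hns : ¬ Summable w) : (cosummable w hw).NeBot := by
  rw [neBot_iff]
  intro h
  have h1 : (∅ : Set ℕ) ∈ cosummable w hw := by simp [h]
  rw [mem_cosummable] at h1
  exact hns (by simpa using h1)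

lemma compl_finset_mem_cosummable (hw : ∀ i, 0 < w i) (H : Finset ℕ) :
    (H : Set ℕ)ᶜ ∈ cosummable w hw := by
  rw [mem_cosummable, compl_compl]
  exact summable_of_hasFiniteSupport (H.finite_toSet.subset Set.support_indicator_subset)

/-- Members of an ultrafilter finer than `cosummable w` carry finite sets of large weight. -/
lemma exists_finset_weight_ge (hw : ∀ i, 0 < w i) {V : Ultrafilter ℕ}
    (hV : (V : Filter ℕ) ≤ cosummable w hw) {S : Set ℕ} (hS : S ∈ V) (W : ℝ) :
    ∃ T : Finset ℕ, (T : Set ℕ) ⊆ S ∧ W ≤ ∑ i ∈ T, w i := by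
  by_contra! h
  have h1 : Sᶜ ∈ cosummable w hw := by
    rw [mem_cosummable, compl_compl]
    exact summable_indicator_of_sum_le hw fun T hT => (h T hT).le
  exact (Ultrafilter.compl_mem_iff_notMem.1 (hV h1)) hS

end Weights

section Duality

/-- A vector outside an isometric copy of a Banach space stays uniformly away from it. -/
lemma exists_norm_le_mul_norm_add_smul [CompleteSpace X] {E : Type*} [NormedAddCommGroup E]
    [NormedSpace 𝕜 E] (ι : X →ₗᵢ[𝕜] E) {φ : E} (hφ : ∀ x, ι x ≠ φ) :
    ∃ c : ℝ, 0 < c ∧ ∀ (x : X) (a : 𝕜), ‖x‖ ≤ c * ‖ι x + a • φ‖ := by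
  have hcl : IsClosed (Set.range ι) := ι.isometry.isUniformInducing.isComplete_range.isClosed
  set d := Metric.infDist φ (Set.range ι)
  have hdpos : 0 < d := (hcl.notMem_iff_infDist_pos (Set.range_nonempty _)).1
    fun ⟨x, hx⟩ => hφ x hx
  refine ⟨1 + ‖φ‖ / d, by positivity, fun x a => ?_⟩
  have h1 : ‖a‖ * d ≤ ‖ι x + a • φ‖ := by
    by_cases ha : a = 0
    · simp [ha]
    have h2 : d ≤ dist φ (ι (-(a⁻¹ • x))) := Metric.infDist_le_dist_of_mem ⟨_, rfl⟩
    have h3 : ι x + a • φ = a • (φ - ι (-(a⁻¹ • x))) := by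
      rw [map_neg, map_smul, sub_neg_eq_add, smul_add, smul_smul, mul_inv_cancel₀ ha, one_smul,
        add_comm]
    rw [h3, norm_smul, ← dist_eq_norm]
    gcongr
  have h4 : ‖x‖ ≤ ‖ι x + a • φ‖ + ‖a‖ * ‖φ‖ := by
    rw [← ι.norm_map x, ← norm_smul]
    simpa using norm_sub_le (ι x + a • φ) (a • φ)
  have h5 : ‖a‖ * ‖φ‖ ≤ ‖φ‖ / d * ‖ι x + a • φ‖ := by
    calc ‖a‖ * ‖φ‖ = ‖φ‖ / d * (‖a‖ * d) := by field_simp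
      _ ≤ _ := by gcongr
  linarith

/-- The norm of `ψ` restricted to `ker φ` is the distance from `ψ` to the line of `φ`. -/
lemma exists_mem_ker_lt_norm {E : Type*} [NormedAddCommGroup E] [NormedSpace 𝕜 E]
    {φ ψ : StrongDual 𝕜 E} {r : ℝ} (hr : 0 ≤ r) (h : ∀ a : 𝕜, r < ‖ψ + a • φ‖) :
    ∃ g : E, φ g = 0 ∧ r * ‖g‖ < ‖ψ g‖ := by
  by_cases h0 : φ = 0
  · by_contra! hcon
    have h1 : r < ‖ψ‖ := by simpa [h0] using h 1
    exact h1.not_ge (ψ.opNorm_le_bound hr fun g => hcon g (by simp [h0]))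
  obtain ⟨g₀, hg₀⟩ : ∃ g₀, φ g₀ ≠ 0 := by
    by_contra! h
    exact h0 (ContinuousLinearMap.ext h)
  let Y : Subspace 𝕜 E := LinearMap.ker φ.toLinearMap
  obtain ⟨H, hH, hHn⟩ := exists_extension_norm_eq Y (ψ.comp Y.subtypeL)
  have hHeq : H = ψ + ((H - ψ) g₀ / φ g₀) • φ := by
    ext g
    have hmem : g - (φ g / φ g₀) • g₀ ∈ Y := by
      change φ (g - (φ g / φ g₀) • g₀) = 0
      simp [hg₀]
    have h1 : H (g - (φ g / φ g₀) • g₀) = ψ (g - (φ g / φ g₀) • g₀) := hH ⟨_, hmem⟩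
    simp only [map_sub, map_smul, smul_eq_mul] at h1
    simp only [add_apply, smul_apply, sub_apply, smul_eq_mul]
    linear_combination h1
  by_contra! hcon
  have h1 : ‖ψ.comp Y.subtypeL‖ ≤ r :=
    ContinuousLinearMap.opNorm_le_bound _ hr fun g => hcon g g.2
  have h2 := h ((H - ψ) g₀ / φ g₀)
  rw [← hHeq, hHn] at h2
  exact h2.not_ge h1

/-- If `φ` in the bidual is zero or not represented by an element of `X`, its kernel is norming
for `X`. -/
lemma exists_norming_ker [CompleteSpace X] (φ : StrongDual 𝕜 (StrongDual 𝕜 X))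
    (hφ : ∀ x : X, (∀ g : StrongDual 𝕜 X, φ g = g x) → φ = 0) :
    ∃ M : ℝ, 0 < M ∧ ∀ x : X, ∃ g : StrongDual 𝕜 X, φ g = 0 ∧ ‖g‖ ≤ M ∧ g x = ‖x‖ := by
  by_cases h0 : φ = 0
  · refine ⟨1, one_pos, fun x => ?_⟩
    obtain ⟨g, hg, hgx⟩ := exists_dual_vector'' 𝕜 x
    exact ⟨g, by simp [h0], hg, hgx⟩
  have hnot : ∀ x, NormedSpace.inclusionInDoubleDualLi (E := X) 𝕜 x ≠ φ := by
    rintro x rfl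
    exact h0 (hφ x fun g => rfl)
  obtain ⟨c, hc, hlow⟩ := @exists_norm_le_mul_norm_add_smul 𝕜 _ X _ _ _
    (StrongDual 𝕜 (StrongDual 𝕜 X)) _ _ (NormedSpace.inclusionInDoubleDualLi 𝕜) φ hnot
  refine ⟨2 * c, by positivity, fun x => ?_⟩
  by_cases hx : x = 0
  · exact ⟨0, by simp, by simp; positivity, by simp [hx]⟩
  have hxpos : 0 < ‖x‖ := norm_pos_iff.2 hx
  obtain ⟨g, hgφ, hg⟩ : ∃ g : StrongDual 𝕜 X, φ g = 0 ∧ ‖x‖ / (2 * c) * ‖g‖ < ‖g x‖ := by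
    refine exists_mem_ker_lt_norm (ψ := NormedSpace.inclusionInDoubleDualLi 𝕜 x)
      (by positivity) fun a => ?_
    rw [div_lt_iff₀ (by positivity)]
    have := hlow x a
    linarith
  have hpos : 0 < ‖g x‖ := lt_of_le_of_lt (by positivity) hg
  refine ⟨((‖x‖ : 𝕜) / g x) • g, by simp [hgφ], ?_, by simp [norm_pos_iff.1 hpos]⟩
  rw [norm_smul, norm_div, RCLike.norm_ofReal, abs_norm, div_mul_eq_mul_div, div_le_iff₀ hpos]
  calc ‖x‖ * ‖g‖ = 2 * c * (‖x‖ / (2 * c) * ‖g‖) := by field_simp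
    _ ≤ _ := by gcongr

/-- A family of functionals attaining norms on all of `X` with uniform bound has, for each finite
dimensional subspace, a finite subfamily that is `1/2`-norming on it. -/
lemma exists_finite_norming (P : StrongDual 𝕜 X → Prop)
    (hP : ∀ x : X, ∃ g : StrongDual 𝕜 X, P g ∧ g x = ‖x‖) (F : Submodule 𝕜 X)
    [FiniteDimensional 𝕜 F] :
    ∃ G : Finset (StrongDual 𝕜 X), (∀ g ∈ G, P g) ∧ ∀ u ∈ F, u ≠ 0 → ∃ g ∈ G, ‖u‖ / 2 ≤ ‖g u‖ := by
  classical
  have := FiniteDimensional.proper_rclike 𝕜 F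
  choose γ hγP hγ using hP
  have hopen : ∀ x : F, IsOpen {u : F | 1 / 2 < ‖γ x u‖} := fun x =>
    isOpen_lt continuous_const (by fun_prop)
  obtain ⟨t, ht⟩ := (isCompact_sphere (0 : F) 1).elim_finite_subcover _ hopen (by
    intro u hu
    have hu1 : ‖(u : X)‖ = 1 := by simpa using hu
    refine Set.mem_iUnion.2 ⟨u, ?_⟩
    simp only [Set.mem_ofPred_eq, hγ, hu1]
    norm_num)
  refine ⟨t.image fun x : F => γ x, ?_, ?_⟩
  · intro g hg
    obtain ⟨x, -, rfl⟩ := Finset.mem_image.1 hg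
    exact hγP x
  · intro u hu hu0
    have hn : 0 < ‖u‖ := norm_pos_iff.2 hu0
    have hmem : (((‖u‖ : 𝕜)⁻¹) • (⟨u, hu⟩ : F)) ∈ Metric.sphere (0 : F) 1 := by
      simp [norm_smul, hn.ne']
    obtain ⟨x, hx, hxu⟩ := Set.mem_iUnion₂.1 (ht hmem)
    refine ⟨γ x, Finset.mem_image_of_mem (fun x : F => γ x) hx, ?_⟩
    simp only [Set.mem_ofPred_eq, Submodule.coe_smul, map_smul, norm_smul, norm_inv,
      RCLike.norm_ofReal, abs_norm] at hxu
    rw [inv_mul_eq_div, lt_div_iff₀ hn] at hxu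
    linarith

end Duality

section Basis

variable {e : ℕ → X} {f : ℕ → X →L[𝕜] 𝕜} {w : ℕ → ℝ} {C s α : ℝ}

namespace IsMarkushevichBasis

lemma exists_bound (hb : IsMarkushevichBasis e f) :
    ∃ α : ℝ, 1 ≤ α ∧ (∀ i, ‖e i‖ ≤ α) ∧ ∀ i x, ‖f i x‖ ≤ α * ‖x‖ := by
  obtain ⟨a, ha⟩ := hb.bddE
  obtain ⟨b, hb⟩ := hb.bddF
  refine ⟨max 1 (max a b), le_max_left _ _, fun i => ?_, fun i x => ?_⟩
  · exact (ha ⟨i, rfl⟩).trans ((le_max_left _ _).trans (le_max_right _ _))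
  · refine (f i).le_of_opNorm_le ?_ x
    exact (hb ⟨i, rfl⟩).trans ((le_max_right _ _).trans (le_max_right _ _))

lemma coord_sum (hb : IsMarkushevichBasis e f) (A : Finset ℕ) (a : ℕ → 𝕜) (i : ℕ) :
    f i (∑ j ∈ A, a j • e j) = if i ∈ A then a i else 0 := by
  simp [map_sum, hb.biorth]

lemma eq_sum (hb : IsMarkushevichBasis e f) {A : Finset ℕ} {y : X} (hy : ∀ i ∉ A, f i y = 0) :
    y = ∑ i ∈ A, f i y • e i := by
  rw [← sub_eq_zero]
  refine hb.total _ fun i => ?_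
  rw [map_sub, hb.coord_sum]
  by_cases hi : i ∈ A <;> simp [hi, hy]

lemma finite_le_norm_coord (hb : IsMarkushevichBasis e f) (x : X) {t : ℝ} (ht : 0 < t) :
    {i | t ≤ ‖f i x‖}.Finite := by
  obtain ⟨α, hα1, -, hα⟩ := hb.exists_bound
  have hspan : ∀ z ∈ Submodule.span 𝕜 (Set.range e), {i | f i z ≠ 0}.Finite := by
    intro z hz
    induction hz using Submodule.span_induction with
    | mem z hz =>
      obtain ⟨j, rfl⟩ := hz
      refine (Set.finite_singleton j).subset fun i hi => ?_
      by_contra hij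
      exact hi (by rw [hb.biorth, if_neg fun h => hij (by simp [h])])
    | zero => simp
    | add y z _ _ hy hz =>
      refine (hy.union hz).subset fun i hi => ?_
      by_contra h
      simp only [Set.mem_union, Set.mem_ofPred_eq, not_or, not_not] at h
      exact hi (by rw [map_add, h.1, h.2, add_zero])
    | smul a y _ hy =>
      exact hy.subset fun i hi h => hi (by rw [map_smul, h, smul_zero])
  obtain ⟨z, hz, hxz⟩ := Metric.mem_closure_iff.1 (hb.dense_span x) (t / α) (by positivity)
  refine (hspan z hz).subset fun i hi h => ?_
  have h1 : ‖f i x‖ ≤ α * ‖x - z‖ := by simpa [h] using hα i (x - z)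
  rw [dist_eq_norm, lt_div_iff₀ (by positivity)] at hxz
  have hi' : t ≤ ‖f i x‖ := hi
  linarith

end IsMarkushevichBasis

/-- A coordinate at least one forces the norm to be bounded below. -/
lemma one_le_mul_norm (hα : ∀ i x, ‖f i x‖ ≤ α * ‖x‖) {B : Finset ℕ} (hB : B.Nonempty) {x : X}
    (hx : ∀ i ∈ B, 1 ≤ ‖f i x‖) : 1 ≤ α * ‖x‖ := by
  obtain ⟨i, hi⟩ := hB
  exact (hx i hi).trans (hα i x)

lemma norm_sum_smul_le_card {A : Finset ℕ} (he : ∀ i, ‖e i‖ ≤ α) {ε : ℕ → 𝕜}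
    (hε : ∀ i ∈ A, ‖ε i‖ = 1) : ‖∑ i ∈ A, ε i • e i‖ ≤ A.card * α := by
  refine (norm_sum_le_of_le A fun i hi => ?_).trans_eq (by rw [Finset.sum_const, nsmul_eq_mul])
  rw [norm_smul, hε i hi, one_mul]
  exact he i

lemma SemiGreedy.exists_finset (hw : ∀ i, 0 < w i) (h : SemiGreedy e f w C s) (x : X) (m : ℕ) :
    ∃ A : Finset ℕ, GreedySet f x m s A ∧ ∃ y : X, (∀ i ∉ A, f i y = 0) ∧
      ∀ (B : Finset ℕ) (z : X), (∀ i ∉ B, f i z = 0) → ∑ i ∈ B, w i ≤ ∑ i ∈ A, w i →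
        ‖x - y‖ ≤ C * ‖x - z‖ := by
  obtain ⟨A, hA, y, hy, hz⟩ := h x m
  refine ⟨A, hA, y, fun i hi => ?_, fun B z hzB hBA => ?_⟩
  · by_contra h
    exact hi (by simpa using hy h)
  · have hsub : msupp f z ⊆ (B : Set ℕ) := by
      intro i hi
      by_contra hiB
      exact hi (hzB i (by simpa using hiB))
    exact hz z (B.finite_toSet.subset hsub) ((ENNReal.tsum_mono_subtype (fun i => ENNReal.ofReal (w i)) hsub).trans
      ((wsum_coe_le_iff hw B A).2 hBA))

/-- A set of dominating coordinates is the only `s`-greedy set of its size. -/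
lemma GreedySet.eq_of_dominating (hs0 : 0 < s) {x : X} {A D : Finset ℕ}
    (hA : GreedySet f x D.card s A) (hD : ∀ k ∈ D, 2 / s ≤ ‖f k x‖)
    (hDc : ∀ j ∉ D, ‖f j x‖ ≤ 1) : A = D := by
  by_contra hne
  have h1 : ¬ A ⊆ D := fun h => hne (Finset.eq_of_subset_of_card_le h hA.1.ge)
  have h2 : ¬ D ⊆ A := fun h => hne (Finset.eq_of_subset_of_card_le h hA.1.le).symm
  obtain ⟨j, hjA, hjD⟩ := Finset.not_subset.1 h1
  obtain ⟨k, hkD, hkA⟩ := Finset.not_subset.1 h2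
  have h3 := hA.2 j hjA k hkA
  have h4 := hD k hkD
  rw [div_le_iff₀ hs0] at h4
  have h5 := hDc j hjD
  linarith

/-- Up to a perturbation supported in `D`, the vector `1_{ε,A}` is controlled by `1_{ε',D}`. -/
lemma SemiGreedy.exists_perturbation (hb : IsMarkushevichBasis e f) (hw : ∀ i, 0 < w i)
    (hs0 : 0 < s) (hsg : SemiGreedy e f w C s) {A D : Finset ℕ} (hAD : Disjoint A D)
    (hwAD : ∑ i ∈ A, w i ≤ ∑ i ∈ D, w i) {ε ε' : ℕ → 𝕜} (hε : ∀ i ∈ A, ‖ε i‖ = 1)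
    (hε' : ∀ i ∈ D, ‖ε' i‖ = 1) :
    ∃ u : X, ‖u‖ ≤ C * (2 / s) * ‖∑ i ∈ D, ε' i • e i‖ ∧
      u = ∑ i ∈ A, ε i • e i + ∑ i ∈ D, f i u • e i := by
  set a := ∑ i ∈ A, ε i • e i with ha
  set b := ∑ i ∈ D, ε' i • e i with hbdef
  have hcoord : ∀ i, f i (a + ((2 / s : ℝ) : 𝕜) • b) =
      (if i ∈ A then ε i else 0) + ((2 / s : ℝ) : 𝕜) * (if i ∈ D then ε' i else 0) := by
    intro i
    rw [map_add, map_smul, ha, hbdef, hb.coord_sum, hb.coord_sum, smul_eq_mul]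
  obtain ⟨A', hA', y, hy, hz⟩ := hsg.exists_finset hw (a + ((2 / s : ℝ) : 𝕜) • b) D.card
  obtain rfl : A' = D := by
    refine hA'.eq_of_dominating hs0 (fun k hk => ?_) (fun j hj => ?_)
    · rw [hcoord, if_neg (Finset.disjoint_right.1 hAD hk), if_pos hk, zero_add, norm_mul, hε' k hk,
        RCLike.norm_ofReal, mul_one]
      exact le_abs_self _
    · rw [hcoord, if_neg hj, mul_zero, add_zero]
      split_ifs with h
      · exact (hε j h).le
      · simp
  refine ⟨a + ((2 / s : ℝ) : 𝕜) • b - y, ?_, ?_⟩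
  · refine (hz A a (fun i hi => ?_) hwAD).trans_eq ?_
    · rw [ha, hb.coord_sum, if_neg hi]
    · rw [add_sub_cancel_left, norm_smul, RCLike.norm_ofReal, abs_of_pos (by positivity), mul_assoc]
  · rw [← sub_eq_iff_eq_add']
    have h1 : ∀ i ∈ A', f i (a + ((2 / s : ℝ) : 𝕜) • b - y) =
        f i (a + ((2 / s : ℝ) : 𝕜) • b - y - a) := by
      intro i hi
      rw [map_sub _ _ a, ha, hb.coord_sum, if_neg (Finset.disjoint_right.1 hAD hi), sub_zero]
    rw [Finset.sum_congr rfl fun i hi => by rw [h1 i hi]]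
    refine hb.eq_sum fun i hi => ?_
    rw [map_sub, map_sub, hcoord, hy i hi, if_neg hi, ha, hb.coord_sum]
    simp

/-- Sets of weight at most `w 0` span uniformly bounded sign sums. -/
lemma SemiGreedy.exists_bound_of_weight_le (hb : IsMarkushevichBasis e f) (hw : ∀ i, 0 < w i)
    (hC : 0 < C) (hs0 : 0 < s) (hsg : SemiGreedy e f w C s) :
    ∃ K : ℝ, 0 < K ∧ ∀ (D : Finset ℕ) (ε : ℕ → 𝕜), 0 ∉ D → ∑ i ∈ D, w i ≤ w 0 →
      (∀ i ∈ D, ‖ε i‖ = 1) → ‖∑ i ∈ D, ε i • e i‖ ≤ K := by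
  obtain ⟨α, hα1, he, hf⟩ := hb.exists_bound
  refine ⟨(1 + α * α) * (C * (2 / s) * α), by positivity, fun D ε h0 hD hε => ?_⟩
  obtain ⟨u, hu, hueq⟩ := hsg.exists_perturbation hb hw hs0 (A := D) (D := {0}) (ε := ε)
    (ε' := fun _ => 1) (by simpa using h0) (by simpa using hD) hε (by simp)
  simp only [Finset.sum_singleton, one_smul] at hu hueq
  have hu' : ‖u‖ ≤ C * (2 / s) * α := hu.trans (by gcongr; exact he 0)
  have h1 : ∑ i ∈ D, ε i • e i = u - f 0 u • e 0 := by
    rw [eq_sub_iff_add_eq, ← hueq]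
  calc ‖∑ i ∈ D, ε i • e i‖ ≤ ‖u‖ + ‖f 0 u‖ * ‖e 0‖ := by
        rw [h1, ← norm_smul]; exact norm_sub_le _ _
    _ ≤ ‖u‖ + α * ‖u‖ * α := by gcongr; exacts [hf 0 u, he 0]
    _ = (1 + α * α) * ‖u‖ := by ring
    _ ≤ _ := by gcongr

lemma exists_unimodular_sum_norm (g : X →L[𝕜] 𝕜) (e : ℕ → X) :
    ∃ ε : ℕ → 𝕜, (∀ i, ‖ε i‖ = 1) ∧ ∀ D : Finset ℕ,
      ∑ i ∈ D, ‖g (e i)‖ ≤ ‖g‖ * ‖∑ i ∈ D, ε i • e i‖ := by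
  have : ∀ z : 𝕜, ∃ c : 𝕜, ‖c‖ = 1 ∧ c * z = (‖z‖ : 𝕜) := by
    intro z
    by_cases hz : z = 0
    · exact ⟨1, by simp, by simp [hz]⟩
    · have h : ‖z‖ ≠ 0 := norm_ne_zero_iff.2 hz
      exact ⟨(‖z‖ : 𝕜) / z, by simp [h], by field_simp⟩
  choose c hc hcz using this
  refine ⟨fun i => c (g (e i)), fun i => hc _, fun D => ?_⟩
  refine le_trans (le_of_eq ?_) (g.le_opNorm _)
  simp only [map_sum, map_smul, smul_eq_mul, hcz]
  rw [← RCLike.ofReal_sum, RCLike.norm_ofReal,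
    abs_of_nonneg (Finset.sum_nonneg fun i _ => norm_nonneg _)]

lemma SemiGreedy.exists_ratio_bound (hb : IsMarkushevichBasis e f) (hw : ∀ i, 0 < w i)
    (hC : 0 < C) (hs0 : 0 < s) (hsg : SemiGreedy e f w C s) :
    ∃ K : ℝ, 0 < K ∧ ∀ g : StrongDual 𝕜 X,
      {n | ‖g (e n)‖ ≤ K * ‖g‖ * w n} ∈ cosummable w hw := by
  obtain ⟨α, hα1, he, hf⟩ := hb.exists_bound
  obtain ⟨K, hK, hbd⟩ := hsg.exists_bound_of_weight_le hb hw hC hs0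
  have hw0 := hw 0
  refine ⟨(K + α) / w 0, by positivity, fun g => ?_⟩
  suffices h : {n | ‖g (e n)‖ ≤ (K + α) / w 0 * ‖g‖ * w n} ∪ {0} ∈ cosummable w hw by
    filter_upwards [h, compl_finset_mem_cosummable hw {0}] with n hn hn0
    rcases hn with hn | hn
    · exact hn
    · exact absurd hn (by simpa using hn0)
  rw [mem_cosummable]
  refine summable_indicator_of_sum_le hw (c := w 0) fun T hT => ?_
  by_contra! hlt
  obtain ⟨D, hDT, n, hnT, hnD, hDw, hnw⟩ := exists_insert_weight_ge (hw 0) T hlt.le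
  have hbig : ∀ i ∈ insert n D, (K + α) / w 0 * ‖g‖ * w i < ‖g (e i)‖ := by
    intro i hi
    have hiT : i ∈ T := by
      rcases Finset.mem_insert.1 hi with rfl | h
      exacts [hnT, hDT h]
    have := hT hiT
    simp at this
    exact this.2
  have h0 : 0 ∉ D := fun h => by simpa using hT (hDT h)
  obtain ⟨ε, hε, hsum⟩ := exists_unimodular_sum_norm g e
  have h1 : ∑ i ∈ D, ‖g (e i)‖ ≤ ‖g‖ * K :=
    (hsum D).trans (by gcongr; exact hbd D ε h0 hDw.le fun i _ => hε i)
  have h2 : ‖g (e n)‖ ≤ ‖g‖ * α := (g.le_opNorm _).trans (by gcongr; exact he n)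
  have h3 : ∑ i ∈ insert n D, (K + α) / w 0 * ‖g‖ * w i < ∑ i ∈ insert n D, ‖g (e i)‖ :=
    Finset.sum_lt_sum_of_nonempty ⟨n, Finset.mem_insert_self _ _⟩ hbig
  rw [← Finset.mul_sum, Finset.sum_insert (f := fun i => ‖g (e i)‖) hnD] at h3
  have h4 : (K + α) / w 0 * ‖g‖ * w 0 ≤ (K + α) / w 0 * ‖g‖ * ∑ i ∈ insert n D, w i := by
    gcongr
  have h5 : (K + α) / w 0 * ‖g‖ * w 0 = ‖g‖ * K + ‖g‖ * α := by field_simp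
  linarith

/-- For a weight of infinite total mass, functionals that are `o(w)` on the basis along a suitable
ultrafilter norm the space. -/
lemma SemiGreedy.exists_asymptotic_norming [CompleteSpace X] (hb : IsMarkushevichBasis e f)
    (hw : ∀ i, 0 < w i) (hC : 0 < C) (hs0 : 0 < s) (hsg : SemiGreedy e f w C s)
    (hns : ¬ Summable w) :
    ∃ V : Ultrafilter ℕ, (V : Filter ℕ) ≤ cosummable w hw ∧ ∃ M : ℝ, 0 < M ∧ ∀ x : X,
      ∃ g : StrongDual 𝕜 X, (‖g‖ ≤ M ∧ ∀ τ > 0, ∀ᶠ n in V, ‖g (e n)‖ ≤ τ * w n) ∧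
        g x = ‖x‖ := by
  obtain ⟨K, hK, hratio⟩ := hsg.exists_ratio_bound hb hw hC hs0
  have := cosummable_neBot hw hns
  let V := Ultrafilter.of (cosummable w hw)
  have hV : (V : Filter ℕ) ≤ cosummable w hw := Ultrafilter.of_le _
  have hlim : ∀ g : StrongDual 𝕜 X, ∃ l : 𝕜, ‖l‖ ≤ K * ‖g‖ ∧
      Tendsto (fun n => g (e n) / (w n : 𝕜)) V (nhds l) := by
    intro g
    have hmem : ∀ᶠ n in V, g (e n) / (w n : 𝕜) ∈ Metric.closedBall (0 : 𝕜) (K * ‖g‖) := by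
      filter_upwards [hV (hratio g)] with n hn
      rw [mem_closedBall_zero_iff, norm_div, RCLike.norm_ofReal, abs_of_pos (hw n),
        div_le_iff₀ (hw n)]
      exact hn
    obtain ⟨l, hl, hle⟩ := (isCompact_closedBall (0 : 𝕜) (K * ‖g‖)).ultrafilter_le_nhds
      (V.map fun n => g (e n) / (w n : 𝕜)) (le_principal_iff.2 hmem)
    exact ⟨l, by simpa using hl, hle⟩
  choose ℓ hℓ hℓt using hlim
  let φ : StrongDual 𝕜 (StrongDual 𝕜 X) := LinearMap.mkContinuous
    { toFun := ℓ
      map_add' := fun g h => tendsto_nhds_unique (hℓt (g + h)) (by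
        simpa [add_div] using (hℓt g).add (hℓt h))
      map_smul' := fun a g => tendsto_nhds_unique (hℓt (a • g)) (by
        simpa [mul_div_assoc] using (hℓt g).const_mul a) } K hℓ
  have hφ : ∀ g, φ g = ℓ g := fun g => rfl
  have hcoord : ∀ i, φ (f i) = 0 := by
    intro i
    refine tendsto_nhds_unique (hℓt (f i)) (tendsto_const_nhds.congr' ?_)
    filter_upwards [hV (compl_finset_mem_cosummable hw {i})] with n hn
    have hne : i ≠ n := fun h => hn (by simp [h])
    simp [hb.biorth, hne]
  obtain ⟨M, hM, hnorm⟩ := exists_norming_ker φ (by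
    intro x hx
    have hx0 : x = 0 := hb.total x fun i => by rw [← hx, hcoord]
    ext g
    simp [hx, hx0])
  refine ⟨V, hV, M, hM, fun x => ?_⟩
  obtain ⟨g, hg0, hgM, hgx⟩ := hnorm x
  refine ⟨g, ⟨hgM, fun τ hτ => ?_⟩, hgx⟩
  have ht := hℓt g
  rw [← hφ, hg0] at ht
  filter_upwards [ht.norm.eventually_le_const (by simpa using hτ)] with n hn
  rwa [norm_div, RCLike.norm_ofReal, abs_of_pos (hw n), div_le_iff₀ (hw n)] at hn

/-- Replacing the large coordinates of `x` by a suitable finite dimensional perturbation. -/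
lemma SemiGreedy.exists_finiteDimensional_perturbation (hb : IsMarkushevichBasis e f)
    (hw : ∀ i, 0 < w i) (hs0 : 0 < s) (hs1 : s ≤ 1) (hsg : SemiGreedy e f w C s)
    {x : X} {B : Finset ℕ} (hx : ∀ i ∈ B, 1 ≤ ‖f i x‖) :
    ∃ F : Submodule 𝕜 X, FiniteDimensional 𝕜 F ∧ ∃ H : Finset ℕ, ∀ D : Finset ℕ,
      Disjoint D H → ∑ i ∈ D, w i ≤ ∑ i ∈ B, w i →
        ∃ u ∈ F, ‖u + ((s ^ 2 / 4 : ℝ) : 𝕜) • ∑ i ∈ D, e i‖ ≤ C * ‖x‖ := by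
  classical
  have hss : s ^ 2 ≤ s := by nlinarith
  have hs2 : 0 < s ^ 2 := by positivity
  obtain ⟨G₁, hG₁⟩ := (hb.finite_le_norm_coord x hs0).exists_finset
  obtain ⟨G₀, hG₀⟩ := (hb.finite_le_norm_coord x hs2).exists_finset
  obtain ⟨H, hH⟩ := (hb.finite_le_norm_coord x (half_pos hs2)).exists_finset
  simp only [Set.mem_ofPred_eq] at hG₁ hG₀ hH
  refine ⟨Submodule.span 𝕜 (insert x (G₀.image e) : Finset X), inferInstance, H,
    fun D hDH hDB => ?_⟩
  set d := ((s ^ 2 / 4 : ℝ) : 𝕜) • ∑ i ∈ D, e i with hd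
  have hdc : ∀ i, f i d = if i ∈ D then ((s ^ 2 / 4 : ℝ) : 𝕜) else 0 := by
    intro i
    have h := hb.coord_sum D (fun _ => 1) i
    simp only [one_smul] at h
    rw [hd, map_smul, h]
    split_ifs <;> simp
  have hoff : ∀ i ∉ D, f i (x + d) = f i x := by
    intro i hi
    rw [map_add, hdc, if_neg hi, add_zero]
  have hon : ∀ i ∈ D, ‖f i (x + d)‖ < s ^ 2 := by
    intro i hi
    have h1 : ‖f i x‖ < s ^ 2 / 2 := by
      by_contra! h
      exact Finset.disjoint_left.1 hDH hi ((hH i).2 h)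
    rw [map_add, hdc, if_pos hi]
    refine (norm_add_le _ _).trans_lt ?_
    rw [RCLike.norm_ofReal, abs_of_pos (by positivity)]
    linarith
  have hnotD : ∀ i, s ≤ ‖f i x‖ → i ∉ D := fun i hi hiD =>
    Finset.disjoint_left.1 hDH hiD ((hH i).2 (by linarith))
  obtain ⟨A, hA, y, hy, hz⟩ := hsg.exists_finset hw (x + d) G₁.card
  have hBA : B ⊆ A := by
    intro i hi
    by_contra hiA
    have hi1 : s ≤ ‖f i x‖ := hs1.trans (hx i hi)
    have hsub : A ⊆ G₁ := by
      intro j hj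
      have h1 := hA.2 j hj i hiA
      rw [hoff i (hnotD i hi1)] at h1
      have h2 : s ≤ ‖f j (x + d)‖ := by nlinarith [hx i hi]
      have hjD : j ∉ D := fun h => by linarith [hon j h]
      rw [hoff j hjD] at h2
      exact (hG₁ j).2 h2
    exact hiA (Finset.eq_of_subset_of_card_le hsub hA.1.ge ▸ (hG₁ i).2 hi1)
  have hAG : A ⊆ G₀ := by
    intro j hj
    have hbig : s ^ 2 ≤ ‖f j (x + d)‖ := by
      by_contra! hlt
      have hjG : j ∉ G₁ := by
        intro h
        have h1 := (hG₁ j).1 h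
        rw [hoff j (hnotD j h1)] at hlt
        linarith
      obtain ⟨k, hkG, hkA⟩ : ∃ k ∈ G₁, k ∉ A := by
        by_contra! h
        exact hjG (Finset.eq_of_subset_of_card_le h hA.1.le ▸ hj)
      have h1 := (hG₁ k).1 hkG
      have h2 := hA.2 j hj k hkA
      rw [hoff k (hnotD k h1)] at h2
      nlinarith
    have hjD : j ∉ D := fun h => (hon j h).not_ge hbig
    rw [hoff j hjD] at hbig
    exact (hG₀ j).2 hbig
  refine ⟨x - y, Submodule.sub_mem _ (Submodule.subset_span (by simp)) ?_, ?_⟩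
  · rw [hb.eq_sum hy]
    refine Submodule.sum_mem _ fun i hi => Submodule.smul_mem _ _ (Submodule.subset_span ?_)
    exact Finset.mem_coe.2 (Finset.mem_insert_of_mem (Finset.mem_image_of_mem e (hAG hi)))
  · have h1 := hz D d (fun i hi => by rw [hdc, if_neg hi]) (hDB.trans
      (Finset.sum_le_sum_of_subset_of_nonneg hBA fun i _ _ => (hw i).le))
    rw [add_sub_cancel_right] at h1
    rwa [sub_add_eq_add_sub]

lemma norm_apply_sum_le (g : StrongDual 𝕜 X) {D : Finset ℕ} {a : ℕ → 𝕜} {W R : ℝ} (hW : 0 < W)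
    (hR : 0 ≤ R) (hD : ∑ i ∈ D, w i ≤ W) (hg : ∀ i ∈ D, ‖g (e i)‖ ≤ 1 / W * w i)
    (ha : ∀ i ∈ D, ‖a i‖ ≤ R) : ‖g (∑ i ∈ D, a i • e i)‖ ≤ R := by
  rw [map_sum]
  calc ‖∑ i ∈ D, g (a i • e i)‖ ≤ ∑ i ∈ D, R * (1 / W * w i) := by
        refine norm_sum_le_of_le D fun i hi => ?_
        rw [map_smul, norm_smul]
        exact mul_le_mul (ha i hi) (hg i hi) (norm_nonneg _) hR
    _ = R * ((∑ i ∈ D, w i) / W) := by rw [← Finset.mul_sum, ← Finset.mul_sum]; ring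
    _ ≤ R * 1 := by gcongr; exact (div_le_one hW).2 hD
    _ = R := mul_one R

/-- Weights of finite total mass: all sign sums are uniformly bounded. -/
lemma SemiGreedy.exists_bound_of_summable (hb : IsMarkushevichBasis e f) (hw : ∀ i, 0 < w i)
    (hC : 0 < C) (hs0 : 0 < s) (hsg : SemiGreedy e f w C s) (hsum : Summable w) :
    ∃ K : ℝ, 0 < K ∧ ∀ (A : Finset ℕ) (ε : ℕ → 𝕜), (∀ i ∈ A, ‖ε i‖ = 1) →
      ‖∑ i ∈ A, ε i • e i‖ ≤ K := by
  classical
  obtain ⟨α, hα1, he, -⟩ := hb.exists_bound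
  obtain ⟨K, hK, hbd⟩ := hsg.exists_bound_of_weight_le hb hw hC hs0
  obtain ⟨T, hT⟩ := hsum.vanishing (Iio_mem_nhds (hw 0))
  refine ⟨(insert 0 T).card * α + K, by positivity, fun A ε hε => ?_⟩
  rw [← Finset.sum_inter_add_sum_sdiff A (insert 0 T)]
  refine (norm_add_le _ _).trans (add_le_add ?_ ?_)
  · refine (norm_sum_smul_le_card he fun i hi => hε i (Finset.mem_inter.1 hi).1).trans ?_
    gcongr
    exact Finset.inter_subset_right
  · refine hbd _ ε (by simp) (le_of_lt (hT _ ?_)) fun i hi => hε i (Finset.mem_sdiff.1 hi).1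
    rw [Finset.disjoint_left]
    intro i hi hiT
    simp [hiT] at hi

/-- Weights of infinite total mass: sign sums are controlled by vectors with large coordinates. -/
lemma SemiGreedy.exists_bound_of_not_summable [CompleteSpace X] (hb : IsMarkushevichBasis e f)
    (hw : ∀ i, 0 < w i) (hC : 0 < C) (hs0 : 0 < s) (hs1 : s ≤ 1) (hsg : SemiGreedy e f w C s)
    (hns : ¬ Summable w) :
    ∃ K : ℝ, 0 < K ∧ ∀ (x : X) (A B : Finset ℕ) (ε : ℕ → 𝕜), A.Nonempty →
      (∀ i ∈ B, 1 ≤ ‖f i x‖) → ∑ i ∈ A, w i ≤ ∑ i ∈ B, w i → (∀ i ∈ A, ‖ε i‖ = 1) →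
        ‖∑ i ∈ A, ε i • e i‖ ≤ K * ‖x‖ := by
  classical
  obtain ⟨α, hα1, he, hf⟩ := hb.exists_bound
  obtain ⟨V, hV, M, hM, hnorming⟩ := hsg.exists_asymptotic_norming hb hw hC hs0 hns
  set c : ℝ := s ^ 2 / 4 with hc
  have hcpos : 0 < c := by positivity
  set K₁ : ℝ := (C + 2 * (M * C + c * α)) / c + α * α with hK₁
  have hK₁pos : 0 < K₁ := by positivity
  refine ⟨(M + α + M * α * α) * (C * (2 / s) * K₁), by positivity,
    fun x A B ε hAne hx hAB hε => ?_⟩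
  have hW : 0 < ∑ i ∈ A, w i := Finset.sum_pos (fun i _ => hw i) hAne
  set W := ∑ i ∈ A, w i
  have hBne : B.Nonempty := by
    rw [Finset.nonempty_iff_ne_empty]
    rintro rfl
    simp at hAB
    linarith
  have hx1 : 1 ≤ α * ‖x‖ := one_le_mul_norm hf hBne hx
  obtain ⟨F, hF, H, hFH⟩ := hsg.exists_finiteDimensional_perturbation hb hw hs0 hs1 hx
  obtain ⟨G, hGP, hG⟩ := exists_finite_norming _ hnorming F
  obtain ⟨gA, ⟨hgAM, hgAV⟩, hgA⟩ := hnorming (∑ i ∈ A, ε i • e i)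
  have hS : ∀ᶠ n in (V : Filter ℕ), n ∈ ((A ∪ H : Finset ℕ) : Set ℕ)ᶜ ∧
      ‖gA (e n)‖ ≤ 1 / W * w n ∧ ∀ g ∈ G, ‖g (e n)‖ ≤ 1 / W * w n := by
    refine Filter.Eventually.and (hV (compl_finset_mem_cosummable hw _))
      ((hgAV _ (by positivity)).and ?_)
    exact (Filter.eventually_all_finset G).2 fun g hg => (hGP g hg).2 _ (by positivity)
  obtain ⟨T, hTS, hTW⟩ := exists_finset_weight_ge hw hV hS W
  obtain ⟨D, hDT, n, hnT, hnD, hDW, hnW⟩ := exists_insert_weight_ge hW T hTW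
  have hone : ∀ E : Finset ℕ, ∑ i ∈ E, e i = ∑ i ∈ E, (1 : 𝕜) • e i := fun E => by simp
  have hnD1 : ‖∑ i ∈ insert n D, e i‖ ≤ K₁ * ‖x‖ := by
    obtain ⟨u, huF, hu⟩ := hFH D (by
      rw [Finset.disjoint_left]
      intro i hi hiH
      exact (hTS (hDT hi)).1 (by simp [hiH])) (hDW.le.trans hAB)
    have hu2 : ‖u‖ ≤ 2 * (M * C + c * α) * ‖x‖ := by
      by_cases hu0 : u = 0
      · rw [hu0, norm_zero]; positivity
      obtain ⟨g, hgG, hgu⟩ := hG u huF hu0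
      have h1 : ‖g (∑ i ∈ D, e i)‖ ≤ 1 := by
        rw [hone]
        exact norm_apply_sum_le g hW zero_le_one hDW.le
          (fun i hi => (hTS (hDT hi)).2.2 g hgG) (by simp)
      have h2 : ‖g (u + (c : 𝕜) • ∑ i ∈ D, e i)‖ ≤ M * (C * ‖x‖) :=
        (g.le_opNorm _).trans (mul_le_mul (hGP g hgG).1 hu (norm_nonneg _) hM.le)
      have h3 : g u = g (u + (c : 𝕜) • ∑ i ∈ D, e i) - (c : 𝕜) * g (∑ i ∈ D, e i) := by
        rw [map_add, map_smul, smul_eq_mul, add_sub_cancel_right]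
      have h4 : ‖g u‖ ≤ M * (C * ‖x‖) + c * 1 := by
        rw [h3]
        refine (norm_sub_le _ _).trans (add_le_add h2 ?_)
        rw [norm_mul, RCLike.norm_ofReal, abs_of_pos hcpos]
        gcongr
      have h5 : c * 1 ≤ c * (α * ‖x‖) := by gcongr
      linarith
    have h6 : c * ‖∑ i ∈ D, e i‖ ≤ (C + 2 * (M * C + c * α)) * ‖x‖ := by
      have h7 : (c : 𝕜) • ∑ i ∈ D, e i = (u + (c : 𝕜) • ∑ i ∈ D, e i) - u := by abel
      have h8 : c * ‖∑ i ∈ D, e i‖ = ‖(c : 𝕜) • ∑ i ∈ D, e i‖ := by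
        rw [norm_smul, RCLike.norm_ofReal, abs_of_pos hcpos]
      rw [h8, h7, add_mul]
      exact (norm_sub_le _ _).trans (add_le_add hu hu2)
    rw [Finset.sum_insert hnD, hK₁, add_mul, add_comm]
    refine (norm_add_le _ _).trans (add_le_add ?_ ?_)
    · rw [div_mul_eq_mul_div, le_div_iff₀ hcpos, mul_comm]
      exact h6
    · rw [mul_assoc]
      exact (he n).trans (le_mul_of_one_le_right (by positivity) hx1)
  have hsubT : insert n D ⊆ T := Finset.insert_subset hnT hDT
  obtain ⟨u, hu, hueq⟩ := hsg.exists_perturbation hb hw hs0 (A := A) (D := insert n D) (ε := ε)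
    (ε' := fun _ => 1) (by
      rw [Finset.disjoint_right]
      intro i hi hiA
      exact (hTS (hsubT hi)).1 (by simp [hiA])) hnW hε (by simp)
  simp only [one_smul] at hu
  have hu' : ‖u‖ ≤ C * (2 / s) * K₁ * ‖x‖ :=
    hu.trans (by rw [mul_assoc _ K₁]; gcongr)
  have hfu : ∀ i, ‖f i u‖ ≤ α * ‖u‖ := fun i => hf i u
  have hgu : ‖gA u‖ ≤ M * ‖u‖ := (gA.le_opNorm _).trans (by gcongr)
  have hgn : ‖gA (f n u • e n)‖ ≤ M * (α * ‖u‖ * α) := by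
    refine (gA.le_opNorm _).trans ?_
    rw [norm_smul]
    gcongr
    exacts [hfu n, he n]
  have hgD : ‖gA (∑ i ∈ D, f i u • e i)‖ ≤ α * ‖u‖ :=
    norm_apply_sum_le gA hW (by positivity) hDW.le (fun i hi => (hTS (hDT hi)).2.1)
      fun i _ => hfu i
  rw [Finset.sum_insert hnD] at hueq
  have hgeq : gA (∑ i ∈ A, ε i • e i) =
      gA u - (gA (f n u • e n) + gA (∑ i ∈ D, f i u • e i)) := by
    rw [← map_add, ← map_sub, eq_sub_of_add_eq hueq.symm]
  have hfin : ‖∑ i ∈ A, ε i • e i‖ ≤ M * ‖u‖ + (M * (α * ‖u‖ * α) + α * ‖u‖) := by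
    calc ‖∑ i ∈ A, ε i • e i‖ = ‖gA (∑ i ∈ A, ε i • e i)‖ := by rw [hgA]; simp
      _ ≤ _ := by
        rw [hgeq]
        exact (norm_sub_le _ _).trans (add_le_add hgu ((norm_add_le _ _).trans
          (add_le_add hgn hgD)))
  calc ‖∑ i ∈ A, ε i • e i‖ ≤ (M + α + M * α * α) * ‖u‖ := by linarith
    _ ≤ (M + α + M * α * α) * (C * (2 / s) * K₁ * ‖x‖) := by gcongr
    _ = _ := by ring

/-- Sign sums are controlled by any vector whose coordinates are at least one on a set of larger
weight. -/
lemma SemiGreedy.exists_norm_sum_le [CompleteSpace X] (hb : IsMarkushevichBasis e f)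
    (hw : ∀ i, 0 < w i) (hC : 0 < C) (hs0 : 0 < s) (hs1 : s ≤ 1) (hsg : SemiGreedy e f w C s) :
    ∃ K : ℝ, 0 < K ∧ ∀ (x : X) (A B : Finset ℕ) (ε : ℕ → 𝕜), (∀ i ∈ B, 1 ≤ ‖f i x‖) →
      ∑ i ∈ A, w i ≤ ∑ i ∈ B, w i → (∀ i ∈ A, ‖ε i‖ = 1) →
        ‖∑ i ∈ A, ε i • e i‖ ≤ K * ‖x‖ := by
  suffices h : ∃ K : ℝ, 0 < K ∧ ∀ (x : X) (A B : Finset ℕ) (ε : ℕ → 𝕜), A.Nonempty →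
      (∀ i ∈ B, 1 ≤ ‖f i x‖) → ∑ i ∈ A, w i ≤ ∑ i ∈ B, w i → (∀ i ∈ A, ‖ε i‖ = 1) →
        ‖∑ i ∈ A, ε i • e i‖ ≤ K * ‖x‖ by
    obtain ⟨K, hK, h⟩ := h
    refine ⟨K, hK, fun x A B ε hx hAB hε => ?_⟩
    rcases A.eq_empty_or_nonempty with rfl | hA
    · simp only [Finset.sum_empty, norm_zero]; positivity
    · exact h x A B ε hA hx hAB hε
  by_cases hsum : Summable w
  · obtain ⟨α, hα1, -, hf⟩ := hb.exists_bound
    obtain ⟨K, hK, hbd⟩ := hsg.exists_bound_of_summable hb hw hC hs0 hsum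
    refine ⟨K * α, by positivity, fun x A B ε hA hx hAB hε => ?_⟩
    have hBne : B.Nonempty := by
      rw [Finset.nonempty_iff_ne_empty]
      rintro rfl
      exact (Finset.sum_pos (fun i _ => hw i) hA).not_ge (by simpa using hAB)
    rw [mul_assoc]
    exact (hbd A ε hε).trans (le_mul_of_one_le_right hK.le (one_le_mul_norm hf hBne hx))
  · exact hsg.exists_bound_of_not_summable hb hw hC hs0 hs1 hsum

lemma norm_sgn (t : 𝕜) : ‖sgn t‖ = 1 := by
  rw [sgn]
  split_ifs with h
  · simp
  · simp [norm_ne_zero_iff.2 h]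

end Basis

/-- every s-w-semi-greedy basis is truncation quasi-greedy, w-superdemocratic
and has the w-Property (A). -/
theorem statement4 {𝕜 : Type*} [RCLike 𝕜] {X : Type*} [NormedAddCommGroup X]
    [NormedSpace 𝕜 X] [CompleteSpace X]
    (e : ℕ → X) (f : ℕ → X →L[𝕜] 𝕜) (hbasis : IsMarkushevichBasis e f)
    (w : ℕ → ℝ) (hw : ∀ i, 0 < w i)
    (C s : ℝ) (hC : 0 < C) (hs0 : 0 < s) (hs1 : s ≤ 1)
    (hsg : SemiGreedy e f w C s) :
    (∃ K : ℝ, 0 < K ∧ TruncationQuasiGreedy e f K) ∧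
    (∃ K : ℝ, 0 < K ∧ SuperDemocratic e f w K) ∧
    (∃ K : ℝ, 0 < K ∧ PropertyA e f w K) := by
  obtain ⟨K, hK, hmain⟩ := hsg.exists_norm_sum_le hbasis hw hC hs0 hs1
  refine ⟨⟨K, hK, fun x m A hA _ => ?_⟩, ⟨K, hK, fun A B ε ε' hε hε' hAB => ?_⟩,
    ⟨1 + K + K, by positivity, fun x _ A B hAB _ hx0 ε ε' hε hε' => ?_⟩⟩
  · set μ := A.inf' hA fun i => ‖f i x‖ with hμ
    have hle : ∀ i ∈ A, μ ≤ ‖f i x‖ := fun i hi => Finset.inf'_le _ hi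
    rcases le_or_gt μ 0 with h0 | hpos
    · exact (mul_nonpos_of_nonpos_of_nonneg h0 (norm_nonneg _)).trans (by positivity)
    · have hnorm : ‖((μ⁻¹ : ℝ) : 𝕜)‖ = μ⁻¹ := by
        rw [RCLike.norm_ofReal, abs_of_pos (by positivity)]
      have h1 := hmain (((μ⁻¹ : ℝ) : 𝕜) • x) A A (fun i => sgn (f i x)) (fun i hi => by
        rw [map_smul, norm_smul, hnorm, inv_mul_eq_div, one_le_div hpos]
        exact hle i hi) le_rfl fun i _ => norm_sgn _
      rw [norm_smul, hnorm] at h1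
      calc μ * ‖∑ i ∈ A, sgn (f i x) • e i‖ ≤ μ * (K * (μ⁻¹ * ‖x‖)) := by gcongr
        _ = K * ‖x‖ := by field_simp
  · refine hmain _ A B ε (fun i hi => ?_) ((wsum_coe_le_iff hw A B).1 hAB) hε
    rw [hbasis.coord_sum, if_pos hi, hε' i hi]
  · have hcoord : ∀ i ∈ B, 1 ≤ ‖f i (x + ∑ j ∈ B, ε' j • e j)‖ := by
      intro i hi
      rw [map_add, hx0 i (Finset.mem_union_right _ hi), hbasis.coord_sum, if_pos hi, zero_add,
        hε' i hi]
    have hA := hmain _ A B ε hcoord ((wsum_coe_le_iff hw A B).1 hAB) hε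
    have hB := hmain _ B B ε' hcoord le_rfl hε'
    calc ‖x + ∑ i ∈ A, ε i • e i‖
        = ‖x + ∑ i ∈ B, ε' i • e i - ∑ i ∈ B, ε' i • e i + ∑ i ∈ A, ε i • e i‖ := by
          rw [add_sub_cancel_right]
      _ ≤ ‖x + ∑ i ∈ B, ε' i • e i‖ + ‖∑ i ∈ B, ε' i • e i‖ + ‖∑ i ∈ A, ε i • e i‖ :=
          (norm_add_le _ _).trans (by gcongr; exact norm_sub_le _ _)
      _ ≤ _ := by linarith

end GreedyPaper
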